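/- arXiv:2603.21451 — 2 statements merged into one kernel-verified Lean document; each statement's English description precedes it below -/
import Mathlib

section
/- Approximation by short sums via the Fourier ratio (Theorem 1.11, abstract Hilbert-space form): Let H be a complex Hilbert space, ι a type, and u : ι → H a family of pairwise orthogonal vectors (⟪u i, u j⟫ = 0 whenever i ≠ j). Suppose f ∈ H with f ≠ 0, HasSum u f, and the norms are summable with S := Σ'_i ‖u i‖ < ∞. Let η > 0 and let k be a positive integer with (k : ℝ) > (S²/‖f‖² − 1)/η². Then there exist a finite subset T ⊆ ι with card T ≤ k and coefficients c : ι → ℂ such that ‖(Σ_{i ∈ T} c i • u i) − f‖ < η · ‖f‖. -/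
open scoped InnerProductSpace in
/-- If `f = ∑ u i` absolutely, with `S = ∑ ‖u i‖`, then any vector `x` can be moved by some
multiple of some `u i`, minus `f`, so that its squared norm grows by at most
`S ^ 2 - ‖f‖ ^ 2`. -/
theorem HasSum.exists_norm_add_smul_sub_sq_le
    {H : Type*} [NormedAddCommGroup H] [InnerProductSpace ℂ H]
    {ι : Type*} {u : ι → H} {f : H} (hf : f ≠ 0) (hsum : HasSum u f)
    (hS : Summable fun i => ‖u i‖) (x : H) :
    ∃ (i : ι) (a : ℂ),
      ‖x + a • u i - f‖ ^ 2 ≤ ‖x‖ ^ 2 + ((∑' i, ‖u i‖) ^ 2 - ‖f‖ ^ 2) := by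
  set S := ∑' i, ‖u i‖
  by_contra! h
  obtain ⟨i₀, hi₀⟩ : ∃ i, u i ≠ 0 := by
    by_contra! h0
    exact hf (hsum.unique (by simp [funext h0]))
  have hw : HasSum (fun i => ‖u i‖) S := hS.hasSum
  have hin : HasSum (fun i => RCLike.re ⟪x - f, u i⟫_ℂ) (RCLike.re ⟪x - f, f⟫_ℂ) :=
    RCLike.hasSum_re ℂ (hsum.mapL (innerSL ℂ (x - f)))
  have key : ∀ i, ‖u i‖ * ‖x + ((S / ‖u i‖ : ℝ) : ℂ) • u i - f‖ ^ 2 =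
      ‖u i‖ * ‖x - f‖ ^ 2 + 2 * S * RCLike.re ⟪x - f, u i⟫_ℂ + S ^ 2 * ‖u i‖ := by
    intro i
    rcases eq_or_ne (u i) 0 with h0 | h0
    · simp [h0]
    have hn : ‖u i‖ ≠ 0 := norm_ne_zero_iff.mpr h0
    rw [add_sub_right_comm, norm_add_sq (𝕜 := ℂ), inner_smul_right, norm_smul,
      RCLike.re_to_complex, RCLike.re_to_complex, Complex.re_ofReal_mul, Complex.norm_real, mul_pow, Real.norm_eq_abs, sq_abs]
    field_simp
  have hL := ((hw.mul_right (‖x - f‖ ^ 2)).add (hin.mul_left (2 * S))).add (hw.mul_left (S ^ 2))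
  simp only [← key] at hL
  have hR := hw.mul_right (‖x‖ ^ 2 + (S ^ 2 - ‖f‖ ^ 2))
  have hlt := hasSum_lt (fun i => mul_le_mul_of_nonneg_left (h i _).le (norm_nonneg (u i)))
    (mul_lt_mul_of_pos_left (h i₀ _) (norm_pos_iff.mpr hi₀)) hR hL
  rw [norm_sub_sq (𝕜 := ℂ), inner_sub_left, map_sub, inner_self_eq_norm_sq] at hlt
  linarith

/-- Maurey's empirical method: if `f = ∑ u i` absolutely, with `S = ∑ ‖u i‖`, then `n • f` is
approximated by a combination of at most `n` of the `u i` with squared error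
`n * (S ^ 2 - ‖f‖ ^ 2)`. -/
theorem HasSum.exists_finsupp_norm_linearCombination_sub_sq_le
    {H : Type*} [NormedAddCommGroup H] [InnerProductSpace ℂ H]
    {ι : Type*} {u : ι → H} {f : H} (hf : f ≠ 0) (hsum : HasSum u f)
    (hS : Summable fun i => ‖u i‖) (n : ℕ) :
    ∃ a : ι →₀ ℂ, a.support.card ≤ n ∧
      ‖Finsupp.linearCombination ℂ u a - (n : ℂ) • f‖ ^ 2 ≤
        n * ((∑' i, ‖u i‖) ^ 2 - ‖f‖ ^ 2) := by
  classical
  induction n with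
  | zero => exact ⟨0, by simp⟩
  | succ n ih =>
    obtain ⟨a, hcard, ha⟩ := ih
    obtain ⟨i, z, hz⟩ := hsum.exists_norm_add_smul_sub_sq_le hf hS
      (Finsupp.linearCombination ℂ u a - (n : ℂ) • f)
    refine ⟨a + Finsupp.single i z, ?_, ?_⟩
    · calc (a + Finsupp.single i z).support.card
          ≤ (a.support ∪ (Finsupp.single i z).support).card :=
            Finset.card_le_card Finsupp.support_add
        _ ≤ a.support.card + (Finsupp.single i z).support.card := Finset.card_union_le _ _
        _ ≤ n + 1 := add_le_add hcard <|
            (Finset.card_le_card Finsupp.support_single_subset).trans_eq (Finset.card_singleton i)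
    · have heq : Finsupp.linearCombination ℂ u (a + Finsupp.single i z) - ((n + 1 : ℕ) : ℂ) • f =
          Finsupp.linearCombination ℂ u a - (n : ℂ) • f + z • u i - f := by
        rw [map_add, Finsupp.linearCombination_single]
        push_cast
        module
      rw [heq]
      push_cast
      linarith


/-- **Approximation by short sums via the Fourier ratio** (Theorem 1.11, abstract
Hilbert-space form): if `f ≠ 0` is the sum of a pairwise-orthogonal family `u` with
`S = Σ_i ‖u i‖ < ∞`, and `k > (S²/‖f‖² - 1)/η²`, then some linear combination of at
most `k` of the `u i` approximates `f` within `η ‖f‖`. -/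
theorem approximation_by_short_sums
    {H : Type*} [NormedAddCommGroup H] [InnerProductSpace ℂ H] [CompleteSpace H]
    {ι : Type*} (u : ι → H)
    (horth : ∀ i j : ι, i ≠ j → (inner ℂ (u i) (u j) : ℂ) = 0)
    (f : H) (hf : f ≠ 0) (hsum : HasSum u f)
    (hS : Summable fun i => ‖u i‖)
    (η : ℝ) (hη : 0 < η) (k : ℕ) (hk0 : 0 < k)
    (hk : ((∑' i, ‖u i‖) ^ 2 / ‖f‖ ^ 2 - 1) / η ^ 2 < (k : ℝ)) :
    ∃ (T : Finset ι) (c : ι → ℂ), T.card ≤ k ∧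
      ‖(∑ i ∈ T, c i • u i) - f‖ < η * ‖f‖ := by
  obtain ⟨a, hcard, ha⟩ := hsum.exists_finsupp_norm_linearCombination_sub_sq_le hf hS k
  have hkpos : (0 : ℝ) < k := Nat.cast_pos.mpr hk0
  have hkne : (k : ℂ) ≠ 0 := Nat.cast_ne_zero.mpr hk0.ne'
  have hfpos : 0 < ‖f‖ := norm_pos_iff.mpr hf
  have hV : (∑' i, ‖u i‖) ^ 2 - ‖f‖ ^ 2 < k * η ^ 2 * ‖f‖ ^ 2 := by
    rw [div_lt_iff₀ (by positivity), sub_lt_iff_lt_add, div_lt_iff₀ (by positivity)] at hk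
    linarith
  have hlt : ‖Finsupp.linearCombination ℂ u a - (k : ℂ) • f‖ < k * (η * ‖f‖) := by
    refine lt_of_pow_lt_pow_left₀ 2 (by positivity) (ha.trans_lt ?_)
    linarith [mul_lt_mul_of_pos_left hV hkpos]
  refine ⟨a.support, fun i => (k : ℂ)⁻¹ * a i, hcard, ?_⟩
  have heq : (∑ i ∈ a.support, ((k : ℂ)⁻¹ * a i) • u i) - f =
      (k : ℂ)⁻¹ • (Finsupp.linearCombination ℂ u a - (k : ℂ) • f) := by
    rw [smul_sub, inv_smul_smul₀ hkne, Finsupp.linearCombination_apply, Finsupp.sum,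
      Finset.smul_sum]
    simp only [mul_smul]
  rw [heq, norm_smul, norm_inv, Complex.norm_natCast, inv_mul_lt_iff₀ hkpos]
  exact hlt
end

section
/- Band-limited converse bound for the Fourier ratio (Theorem 1.13, abstract Hilbert-space form): Let H be a complex Hilbert space, J and I types, e : J → H an orthonormal family, and g : J → I a grouping map (grouping basis indices into eigenspaces). Let J₀ be a finite subset of J with card J₀ = N, and let f ∈ H be nonzero with f lying in the closed span of {e j : j ∈ J₀}. Let T be a finite subset of J with card T = k, let P lie in the span of {e j : j ∈ T}, and let 0 < η < 1 satisfy ‖f − P‖ ≤ η·‖f‖. Then Σ'_{i ∈ I} (Σ_{j ∈ J₀, g j = i} |⟪e j, f⟫|²)^{1/2} ≤ ((1+η)·√k + η·√N) · ‖f‖. -/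
/-- Cauchy–Schwarz and Bessel: the `ℓ¹` norm of finitely many Fourier coefficients. -/
theorem Orthonormal.sum_norm_inner_le_sqrt_card_mul_norm
    {𝕜 E ι : Type*} [RCLike 𝕜] [NormedAddCommGroup E] [InnerProductSpace 𝕜 E]
    {v : ι → E} (hv : Orthonormal 𝕜 v) (s : Finset ι) (x : E) :
    ∑ j ∈ s, ‖inner 𝕜 (v j) x‖ ≤ √(s.card : ℝ) * ‖x‖ := by
  have hcs := sq_sum_le_card_mul_sum_sq (s := s) (f := fun j => ‖inner 𝕜 (v j) x‖)
  have hbessel := hv.sum_inner_products_le (s := s) x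
  refine le_of_sq_le_sq ?_ (by positivity)
  rw [mul_pow, Real.sq_sqrt (Nat.cast_nonneg _)]
  exact hcs.trans (by gcongr)

theorem Orthonormal.inner_eq_zero_of_mem_span_image
    {𝕜 E ι : Type*} [RCLike 𝕜] [NormedAddCommGroup E] [InnerProductSpace 𝕜 E]
    {v : ι → E} (hv : Orthonormal 𝕜 v) {s : Set ι} {j : ι} (hj : j ∉ s) {x : E}
    (hx : x ∈ Submodule.span 𝕜 (v '' s)) : inner 𝕜 (v j) x = 0 := by
  induction hx using Submodule.span_induction with
  | mem y hy =>
    obtain ⟨i, hi, rfl⟩ := hy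
    exact hv.2 fun h => hj (h ▸ hi)
  | zero => exact inner_zero_right _
  | add y z _ _ hy hz => rw [inner_add_right, hy, hz, add_zero]
  | smul a y _ hy => rw [inner_smul_right, hy, mul_zero]

/-- The grouped `ℓ¹(ℓ²)` norm of a finite family is at most its `ℓ¹` norm. -/
theorem tsum_sqrt_sum_fiber_sq_le_sum {ι κ : Type*} [DecidableEq κ] (g : ι → κ) (s : Finset ι)
    {a : ι → ℝ} (ha : ∀ j, 0 ≤ a j) :
    ∑' i, √(∑ j ∈ s.filter (fun j => g j = i), a j ^ 2) ≤ ∑ j ∈ s, a j := by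
  rw [tsum_eq_sum (s := s.image g), ← Finset.sum_fiberwise_of_maps_to
    (fun j hj => Finset.mem_image_of_mem g hj) a]
  · refine Finset.sum_le_sum fun i _ => ?_
    exact Real.sqrt_le_iff.2 ⟨Finset.sum_nonneg fun j _ => ha j,
      Finset.sum_sq_le_sq_sum_of_nonneg fun j _ => ha j⟩
  · intro i hi
    rw [Finset.filter_eq_empty_iff.2 fun j hj (h : g j = i) =>
      hi (h ▸ Finset.mem_image_of_mem g hj)]
    simp


/-- **Band-limited converse bound for the Fourier ratio** (Theorem 1.13, abstract
Hilbert-space form): if `f` lies in the span of the orthonormal vectors indexed by a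
finite set `J₀` of size `N` (band-limitation), and `P`, a combination of `k` of the
orthonormal vectors, satisfies `‖f - P‖ ≤ η ‖f‖`, then the grouped `ℓ̂¹` norm of `f`
satisfies `‖f‖_{ℓ̂¹} ≤ ((1+η)√k + η√N) ‖f‖`, i.e. `FR(f) ≤ (1+η)√k + η√N`. -/
theorem bandlimited_converse_fourier_ratio
    {H : Type*} [NormedAddCommGroup H] [InnerProductSpace ℂ H] [CompleteSpace H]
    {J I : Type*} [DecidableEq I] (e : J → H) (he : Orthonormal ℂ e) (g : J → I)
    (J₀ : Finset J) (N : ℕ) (hN : J₀.card = N)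
    (f : H) (hf : f ≠ 0)
    (hband : f ∈ Submodule.span ℂ (e '' (J₀ : Set J)))
    (T : Finset J) (k : ℕ) (hk : T.card = k)
    (P : H) (hP : P ∈ Submodule.span ℂ (e '' (T : Set J)))
    (η : ℝ) (hη0 : 0 < η) (hη1 : η < 1)
    (happrox : ‖f - P‖ ≤ η * ‖f‖) :
    (∑' i : I, Real.sqrt (∑ j ∈ J₀.filter (fun j => g j = i), ‖(inner ℂ (e j) f : ℂ)‖ ^ 2))
      ≤ ((1 + η) * Real.sqrt k + η * Real.sqrt N) * ‖f‖ := by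
  classical
  refine (tsum_sqrt_sum_fiber_sq_le_sum g J₀ fun j => norm_nonneg (inner ℂ (e j) f)).trans ?_
  have hout : ∑ j ∈ J₀ \ T, ‖(inner ℂ (e j) f : ℂ)‖ ≤ √(N : ℝ) * (η * ‖f‖) := by
    calc
      _ = ∑ j ∈ J₀ \ T, ‖(inner ℂ (e j) (f - P) : ℂ)‖ := by
        refine Finset.sum_congr rfl fun j hj => ?_
        rw [inner_sub_right, he.inner_eq_zero_of_mem_span_image
          (by simpa using (Finset.mem_sdiff.1 hj).2) hP, sub_zero]
      _ ≤ ∑ j ∈ J₀, ‖(inner ℂ (e j) (f - P) : ℂ)‖ :=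
        Finset.sum_le_sum_of_subset_of_nonneg Finset.sdiff_subset fun _ _ _ => norm_nonneg _
      _ ≤ √(N : ℝ) * ‖f - P‖ := hN ▸ he.sum_norm_inner_le_sqrt_card_mul_norm J₀ _
      _ ≤ √(N : ℝ) * (η * ‖f‖) := by gcongr
  have hin : ∑ j ∈ J₀ ∩ T, ‖(inner ℂ (e j) f : ℂ)‖ ≤ √(k : ℝ) * ‖f‖ :=
    (Finset.sum_le_sum_of_subset_of_nonneg Finset.inter_subset_right
      fun _ _ _ => norm_nonneg _).trans (hk ▸ he.sum_norm_inner_le_sqrt_card_mul_norm T f)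
  have hnonneg : 0 ≤ η * √(k : ℝ) * ‖f‖ := by positivity
  rw [← Finset.sum_inter_add_sum_sdiff J₀ T]
  linarith
end
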